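/- Proposition (rank2): If an n-qubit pure state |ψ⟩ and an n-qubit mixed density matrix ω have the same (n−1)-qubit reduced density matrices for every single-qubit partial trace, then ω has rank exactly 2. -/

import Mathlib

open Matrix
open scoped ComplexOrder

/-- Insert the bit `b` into slot `j` of the partial assignment `x` of bits to
the qubits other than `j`. -/
def emb {n : ℕ} (j : Fin n) (x : {k : Fin n // k ≠ j} → Fin 2) (b : Fin 2) :
    Fin n → Fin 2 :=
  fun k => if h : k = j then b else x ⟨k, h⟩

/-- The partial trace of an `n`-qubit operator over qubit `j`, an operator on
the remaining `n−1` qubits. -/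
noncomputable def ptrace {n : ℕ} (j : Fin n) (ρ : Matrix (Fin n → Fin 2) (Fin n → Fin 2) ℂ) :
    Matrix ({k : Fin n // k ≠ j} → Fin 2) ({k : Fin n // k ≠ j} → Fin 2) ℂ :=
  fun x y => ∑ b : Fin 2, ρ (emb j x b) (emb j y b)

/-- |ψ⟩⟨ψ| as a matrix. -/
noncomputable def proj {m : Type*} (ψ : m → ℂ) : Matrix m m ℂ :=
  Matrix.vecMulVec ψ (star ψ)

/-- The single-qubit operator `A` acting on qubit `j` of the vector `ψ`, linearly in `A`. -/
noncomputable def localAct {n : ℕ} (j : Fin n) (ψ : (Fin n → Fin 2) → ℂ) :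
    Matrix (Fin 2) (Fin 2) ℂ →ₗ[ℂ] ((Fin n → Fin 2) → ℂ) where
  toFun A x := ∑ b, A (x j) b * ψ (Function.update x j b)
  map_add' A B := by
    ext x
    simp [add_mul, Finset.sum_add_distrib]
  map_smul' c A := by
    ext x
    simp [mul_add, mul_assoc]

theorem localAct_apply {n : ℕ} (j : Fin n) (ψ : (Fin n → Fin 2) → ℂ)
    (A : Matrix (Fin 2) (Fin 2) ℂ) (x : Fin n → Fin 2) :
    localAct j ψ A x = ∑ b, A (x j) b * ψ (Function.update x j b) := rfl

theorem localAct_zero {n : ℕ} (j : Fin n) (A : Matrix (Fin 2) (Fin 2) ℂ) :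
    localAct j 0 A = 0 := by
  ext x
  simp [localAct_apply]

theorem localAct_mul {n : ℕ} (j : Fin n) (ψ : (Fin n → Fin 2) → ℂ)
    (A B : Matrix (Fin 2) (Fin 2) ℂ) :
    localAct j ψ (A * B) = localAct j (localAct j ψ B) A := by
  ext x
  simp only [localAct_apply, Matrix.mul_apply, Function.update_self, Function.update_idem,
    Fin.sum_univ_two]
  ring

theorem localAct_comm {n : ℕ} {j k : Fin n} (h : j ≠ k) (ψ : (Fin n → Fin 2) → ℂ)
    (A B : Matrix (Fin 2) (Fin 2) ℂ) :
    localAct j (localAct k ψ B) A = localAct k (localAct j ψ A) B := by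
  ext x
  simp only [localAct_apply, Function.update_of_ne h, Function.update_of_ne h.symm,
    Function.update_comm h, Fin.sum_univ_two]
  ring

/-- Two operators on qubit `j` whose effect on `ψ` can be reproduced on two further distinct
qubits `k` and `l` respectively commute on `ψ`. -/
theorem localAct_mul_comm {n : ℕ} {j k l : Fin n} (hjk : j ≠ k) (hjl : j ≠ l) (hkl : k ≠ l)
    (ψ : (Fin n → Fin 2) → ℂ) {A A' B C : Matrix (Fin 2) (Fin 2) ℂ}
    (hB : localAct k ψ B = localAct j ψ A) (hC : localAct l ψ C = localAct j ψ A') :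
    localAct j ψ (A' * A) = localAct j ψ (A * A') := by
  rw [localAct_mul, localAct_mul, ← hB, localAct_comm hjk, ← hC, localAct_comm hkl, hB,
    localAct_comm hjl]

theorem finrank_le_two_of_commute (S : Submodule ℂ (Matrix (Fin 2) (Fin 2) ℂ))
    (hS : ∀ A ∈ S, ∀ B ∈ S, A * B = B * A) : Module.finrank ℂ S ≤ 2 := by
  suffices h : ∃ A : Matrix (Fin 2) (Fin 2) ℂ, S ≤ Submodule.span ℂ (Set.range ![1, A]) by
    obtain ⟨A, hA⟩ := h
    calc Module.finrank ℂ S ≤ Module.finrank ℂ (Submodule.span ℂ (Set.range ![1, A])) :=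
          Submodule.finrank_mono hA
      _ ≤ 2 := finrank_range_le_card (R := ℂ) ![1, A]
  have mem_of {A X : Matrix (Fin 2) (Fin 2) ℂ} (y : ℂ) (h01 : X 0 1 = y * A 0 1)
      (h10 : X 1 0 = y * A 1 0) (hd : X 0 0 - X 1 1 = y * (A 0 0 - A 1 1)) :
      X ∈ Submodule.span ℂ (Set.range ![1, A]) := by
    rw [Submodule.mem_span_range_iff_exists_fun]
    refine ⟨![X 0 0 - y * A 0 0, y], ?_⟩
    ext a b
    fin_cases a <;> fin_cases b <;> simp [h01, h10]
    linear_combination hd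
  by_cases hsc : ∀ A ∈ S, A 0 1 = 0 ∧ A 1 0 = 0 ∧ A 0 0 - A 1 1 = 0
  · refine ⟨1, fun X hX => ?_⟩
    obtain ⟨h1, h2, h3⟩ := hsc X hX
    exact mem_of 0 (by simp [h1]) (by simp [h2]) (by simp [h3])
  · push Not at hsc
    obtain ⟨A, hA, hne⟩ := hsc
    refine ⟨A, fun X hX => ?_⟩
    have hc := hS A hA X hX
    have e00 := congrFun₂ hc 0 0
    have e01 := congrFun₂ hc 0 1
    have e10 := congrFun₂ hc 1 0
    simp only [Matrix.mul_apply, Fin.sum_univ_two] at e00 e01 e10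
    by_cases h1 : A 0 1 = 0
    · by_cases h2 : A 1 0 = 0
      · have h3 := hne h1 h2
        refine mem_of ((X 0 0 - X 1 1) / (A 0 0 - A 1 1)) ?_ ?_ ?_ <;> field_simp
        · linear_combination e01
        · linear_combination -e10
      · refine mem_of (X 1 0 / A 1 0) ?_ ?_ ?_ <;> field_simp
        · linear_combination -e00
        · linear_combination e10
    · refine mem_of (X 0 1 / A 0 1) ?_ ?_ ?_ <;> field_simp
      · linear_combination e00
      · linear_combination -e01

theorem finrank_range_localAct_le_two {n : ℕ} (j : Fin n) (ψ : (Fin n → Fin 2) → ℂ)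
    (h : ¬ Function.Injective (localAct j ψ)) :
    Module.finrank ℂ (LinearMap.range (localAct j ψ)) ≤ 2 := by
  rw [injective_iff_map_eq_zero] at h
  push Not at h
  obtain ⟨A, hA, hne⟩ := h
  obtain ⟨i, hi⟩ : ∃ i, A i ≠ 0 := Function.ne_iff.mp hne
  obtain ⟨c, hc⟩ : ∃ c, A i c ≠ 0 := Function.ne_iff.mp hi
  have hker : ∀ v : Fin 2 → ℂ, vecMulVec v (A i) ∈ LinearMap.ker (localAct j ψ) := by
    intro v
    have hv : vecMulVec v (A i) = vecMulVec v (Pi.single i 1) * A := by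
      ext a b
      simp [Matrix.mul_apply, vecMulVec_apply, Pi.single_apply]
    rw [LinearMap.mem_ker, hv, localAct_mul, hA, localAct_zero]
  let f : (Fin 2 → ℂ) →ₗ[ℂ] LinearMap.ker (localAct j ψ) :=
    { toFun := fun v => ⟨vecMulVec v (A i), hker v⟩
      map_add' := fun v w => Subtype.ext (add_vecMulVec v w (A i))
      map_smul' := fun r v => Subtype.ext (smul_vecMulVec r v (A i)) }
  have hf : Function.Injective f := by
    intro v w hvw
    ext a
    have := congrFun₂ (congrArg Subtype.val hvw) a c
    exact mul_right_cancel₀ hc this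
  have h2 := LinearMap.finrank_le_finrank_of_injective hf
  have h4 := LinearMap.finrank_range_add_finrank_ker (localAct j ψ)
  simp only [Module.finrank_matrix, Module.finrank_fintype_fun_eq_card, Fintype.card_fin,
    Module.finrank_self] at h2 h4
  omega

theorem finrank_le_two_of_le_range_localAct {n : ℕ} {j k l : Fin n}
    (hjk : j ≠ k) (hjl : j ≠ l) (hkl : k ≠ l) (ψ : (Fin n → Fin 2) → ℂ)
    (W : Submodule ℂ ((Fin n → Fin 2) → ℂ))
    (hW : ∀ i, W ≤ LinearMap.range (localAct i ψ)) : Module.finrank ℂ W ≤ 2 := by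
  by_cases hinj : Function.Injective (localAct j ψ)
  · have hmap : (W.comap (localAct j ψ)).map (localAct j ψ) = W :=
      Submodule.map_comap_eq_of_le (hW j)
    rw [← hmap]
    refine (Submodule.finrank_map_le _ _).trans (finrank_le_two_of_commute _ ?_)
    intro A hA A' hA'
    obtain ⟨B, hB⟩ := hW k hA
    obtain ⟨C, hC⟩ := hW l hA'
    exact (hinj (localAct_mul_comm hjk hjl hkl ψ hB hC)).symm
  · exact (Submodule.finrank_mono (hW j)).trans (finrank_range_localAct_le_two j ψ hinj)

theorem emb_restrict {n : ℕ} (j : Fin n) (x : Fin n → Fin 2) (b : Fin 2) :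
    emb j (fun k => x k) b = Function.update x j b := by
  ext k
  by_cases h : k = j
  · subst h
    simp [emb]
  · simp [emb, h]

theorem mem_range_localAct {n : ℕ} (j : Fin n) (ψ φ : (Fin n → Fin 2) → ℂ)
    (h : ∀ c, (fun x => φ (emb j x c)) ∈
      Submodule.span ℂ (Set.range fun b x => ψ (emb j x b))) :
    φ ∈ LinearMap.range (localAct j ψ) := by
  simp only [Submodule.mem_span_range_iff_exists_fun] at h
  choose A hA using h
  refine ⟨Matrix.of A, ?_⟩
  ext x
  have := congrFun (hA (x j)) (fun k => x k)
  simpa [emb_restrict, localAct_apply] using this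

theorem ptrace_eq_sum {n : ℕ} (j : Fin n) (ρ : Matrix (Fin n → Fin 2) (Fin n → Fin 2) ℂ) :
    ptrace j ρ = ∑ b, ρ.submatrix (emb j · b) (emb j · b) := by
  ext x y
  simp [ptrace]

theorem mem_span_of_forall_dotProduct_star {m ι : Type*} [Fintype m] (s : ι → m → ℂ) (φ : m → ℂ)
    (h : ∀ v : m → ℂ, (∀ i, star v ⬝ᵥ s i = 0) → star v ⬝ᵥ φ = 0) :
    φ ∈ Submodule.span ℂ (Set.range s) := by
  classical
  by_contra hφ
  obtain ⟨f, hf, hle⟩ := Submodule.exists_le_ker_of_notMem hφ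
  have hrep : ∀ y : m → ℂ, star (star fun i => f (Pi.single i 1)) ⬝ᵥ y = f y := by
    intro y
    rw [star_star, f.pi_apply_eq_sum_univ y]
    refine Finset.sum_congr rfl fun i _ => ?_
    rw [smul_eq_mul, mul_comm]
    congr 1
    refine congrArg f ?_
    ext k
    simp [Pi.single_apply, eq_comm]
  refine hf ?_
  rw [← hrep]
  refine h _ fun i => ?_
  rw [hrep]
  exact hle (Submodule.subset_span ⟨i, rfl⟩)

open scoped MatrixOrder Matrix.Norms.L2Operator in
theorem range_mulVecLin_le_range_localAct {n : ℕ} (j : Fin n) (ψ : (Fin n → Fin 2) → ℂ)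
    (ω : Matrix (Fin n → Fin 2) (Fin n → Fin 2) ℂ) (hω : ω.PosSemidef)
    (hsame : ptrace j (proj ψ) = ptrace j ω) :
    LinearMap.range ω.mulVecLin ≤ LinearMap.range (localAct j ψ) := by
  rintro _ ⟨u, rfl⟩
  refine mem_range_localAct j ψ _ fun c => mem_span_of_forall_dotProduct_star _ _ fun v hv => ?_
  obtain ⟨B, rfl⟩ : ∃ B, ω = Bᴴ * B := by
    classical
    exact CStarAlgebra.nonneg_iff_eq_star_mul_self.mp hω.nonneg
  have hslice : ∀ b : Fin 2, (Bᴴ * B).submatrix (emb j · b) (emb j · b) =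
      (B.submatrix id (emb j · b))ᴴ * B.submatrix id (emb j · b) := fun b => rfl
  have hpure : ptrace j (proj ψ) *ᵥ v = 0 := by
    rw [ptrace_eq_sum, Matrix.sum_mulVec]
    refine Finset.sum_eq_zero fun b _ => ?_
    have hb : star (fun x => ψ (emb j x b)) ⬝ᵥ v = 0 := by
      have := congrArg star (hv b)
      rwa [star_zero, Matrix.star_dotProduct, star_star] at this
    have hp : (proj ψ).submatrix (emb j · b) (emb j · b) =
      vecMulVec (fun x => ψ (emb j x b)) (star fun x => ψ (emb j x b)) := rfl
    rw [hp, Matrix.vecMulVec_mulVec, hb]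
    simp
  have hsum : ∑ b, star (B.submatrix id (emb j · b) *ᵥ v) ⬝ᵥ
      (B.submatrix id (emb j · b) *ᵥ v) = 0 := by
    have h0 : star v ⬝ᵥ (ptrace j (Bᴴ * B) *ᵥ v) = 0 := by
      rw [← hsame, hpure, dotProduct_zero]
    rw [ptrace_eq_sum, Matrix.sum_mulVec, dotProduct_sum] at h0
    rw [← h0]
    refine Finset.sum_congr rfl fun b _ => ?_
    rw [hslice, ← Matrix.mulVec_mulVec, Matrix.dotProduct_mulVec (star v), Matrix.star_mulVec]
  have hc : B.submatrix id (emb j · c) *ᵥ v = 0 := by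
    rw [Finset.sum_eq_zero_iff_of_nonneg fun b _ => dotProduct_star_self_nonneg _] at hsum
    exact dotProduct_star_self_eq_zero.mp (hsum c (Finset.mem_univ c))
  have hφ : (fun x => (Bᴴ * B).mulVecLin u (emb j x c)) =
      (B.submatrix id (emb j · c))ᴴ *ᵥ (B *ᵥ u) := by
    rw [Matrix.mulVecLin_apply, ← Matrix.mulVec_mulVec]
    rfl
  rw [hφ, Matrix.dotProduct_mulVec, ← Matrix.star_mulVec, hc, star_zero, zero_dotProduct]

/-- Proposition (rank2): if an n-qubit pure state ψ and a mixed density matrix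
ω have the same reduced density matrices under every single-qubit partial
trace, then ω has rank exactly 2. -/
theorem stmt15 {n : ℕ} (hn : 3 ≤ n)
    (ψ : (Fin n → Fin 2) → ℂ) (hψ : star ψ ⬝ᵥ ψ = 1)
    (ω : Matrix (Fin n → Fin 2) (Fin n → Fin 2) ℂ)
    (hω : ω.PosSemidef) (hωtr : ω.trace = 1) (hmixed : 2 ≤ ω.rank)
    (hsame : ∀ j : Fin n, ptrace j (proj ψ) = ptrace j ω) :
    ω.rank = 2 := by
  refine le_antisymm ?_ hmixed
  refine finrank_le_two_of_le_range_localAct (j := ⟨0, by omega⟩) (k := ⟨1, by omega⟩)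
    (l := ⟨2, by omega⟩) (by simp) (by simp) (by simp) ψ _ fun j =>
      range_mulVecLin_le_range_localAct j ψ ω hω (hsame j)
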